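/- Let T be the infinite rooted k-ary tree with k ≥ 2 and s > 1. For every weight w ≥ 0 on T, every f ∈ L¹(T), and every λ > 0, w({x ∈ T : Mf(x) > λ}) ≤ c_s (1/λ) Σ_{x∈T} |f(x)| M_s w(x), where M is the centered Hardy–Littlewood maximal operator, M_s w = (M(w^s))^{1/s}, and c_s depends only on s (independent of k). -/

import Mathlib

open scoped ENNReal NNReal BigOperators

noncomputable section

/-- Vertices of the infinite rooted `k`-ary tree: finite words over `Fin k`. -/
abbrev V (k : ℕ) := List (Fin k)

/-- Length of the longest common prefix (depth of the deepest common ancestor). -/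
def lcpLen {k : ℕ} : List (Fin k) → List (Fin k) → ℕ
  | a :: as, b :: bs => if a = b then lcpLen as bs + 1 else 0
  | _, _ => 0

/-- Graph distance on the infinite rooted `k`-ary tree. -/
def tdist {k : ℕ} (x y : V k) : ℕ :=
  (x.length - lcpLen x y) + (y.length - lcpLen x y)

/-- Sphere of radius `r` centered at `x`. -/
def sph {k : ℕ} (x : V k) (r : ℕ) : Set (V k) := {y | tdist x y = r}

/-- Closed ball of radius `r` centered at `x`. -/
def ball {k : ℕ} (x : V k) (r : ℕ) : Set (V k) := {y | tdist x y ≤ r}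

def sphCard {k : ℕ} (x : V k) (r : ℕ) : ℝ≥0∞ := ((sph x r).ncard : ℝ≥0∞)
def ballCard {k : ℕ} (x : V k) (r : ℕ) : ℝ≥0∞ := ((ball x r).ncard : ℝ≥0∞)

/-- `w(A) = Σ_{y ∈ A} w(y)`, the weighted (counting) measure of `A`. -/
def wsum {k : ℕ} (w : V k → ℝ≥0∞) (A : Set (V k)) : ℝ≥0∞ := ∑' y : A, w ↑y

/-- Spherical average `A_r° f (x)`. -/
def sphAvg {k : ℕ} (f : V k → ℝ≥0∞) (x : V k) (r : ℕ) : ℝ≥0∞ :=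
  wsum f (sph x r) / sphCard x r

/-- Spherical maximal operator `M°`. -/
def Msph {k : ℕ} (f : V k → ℝ≥0∞) (x : V k) : ℝ≥0∞ := ⨆ r : ℕ, sphAvg f x r

/-- Centered Hardy–Littlewood maximal operator `M`. -/
def Mball {k : ℕ} (f : V k → ℝ≥0∞) (x : V k) : ℝ≥0∞ :=
  ⨆ r : ℕ, wsum f (ball x r) / ballCard x r

/-- `|f|` of a real-valued function, as an `ℝ≥0∞`-valued function. -/
def absE {k : ℕ} (f : V k → ℝ) : V k → ℝ≥0∞ := fun y => ENNReal.ofReal |f y|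

/-- `M_s w = (M(w^s))^{1/s}` (centered version). -/
def MsBall {k : ℕ} (s : ℝ) (w : V k → ℝ≥0∞) (x : V k) : ℝ≥0∞ :=
  (Mball (fun y => w y ^ s) x) ^ (1 / s)

/-- `M_s° w = (M°(w^s))^{1/s}` (spherical version). -/
def MsSph {k : ℕ} (s : ℝ) (w : V k → ℝ≥0∞) (x : V k) : ℝ≥0∞ :=
  (Msph (fun y => w y ^ s) x) ^ (1 / s)

/-! ## Combinatorics of the tree -/

theorem lcp_comm {k : ℕ} : ∀ x y : V k, lcpLen x y = lcpLen y x
  | [], [] => rfl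
  | [], _ :: _ => rfl
  | _ :: _, [] => rfl
  | a :: as, b :: bs => by
      simp only [lcpLen, lcp_comm as bs, eq_comm]

theorem lcp_le {k : ℕ} : ∀ x y : V k, lcpLen x y ≤ x.length
  | [], [] => by simp [lcpLen]
  | [], _ :: _ => by simp [lcpLen]
  | _ :: _, [] => by simp [lcpLen]
  | a :: as, b :: bs => by
      have := lcp_le as bs
      simp only [lcpLen, List.length_cons]
      split_ifs <;> omega

theorem lcp_take {k : ℕ} : ∀ x y : V k, x.take (lcpLen x y) = y.take (lcpLen x y)
  | [], [] => by simp [lcpLen]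
  | [], _ :: _ => by simp [lcpLen]
  | _ :: _, [] => by simp [lcpLen]
  | a :: as, b :: bs => by
      have := lcp_take as bs
      simp only [lcpLen]
      split_ifs with h
      · simp [h, this]
      · simp

theorem lcp_append {k : ℕ} : ∀ x u : V k, lcpLen x (x ++ u) = x.length
  | [], [] => by simp [lcpLen]
  | [], _ :: _ => by simp [lcpLen]
  | a :: as, u => by
      simp [lcpLen, lcp_append as u]

/-- Height of `x` above the common ancestor of `x` and `y`. -/
def ix {k : ℕ} (x y : V k) : ℕ := x.length - lcpLen x y

theorem tdist_eq {k : ℕ} (x y : V k) : tdist x y = ix x y + ix y x := by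
  simp [tdist, ix, lcp_comm y x]

theorem tdist_comm' {k : ℕ} (x y : V k) : tdist x y = tdist y x := by
  rw [tdist_eq, tdist_eq, add_comm]

/-- Points `y` with `ix x y = i` and `ix y x = j` lie in a finset of size at most `k ^ j`. -/
theorem exists_finset {k : ℕ} (x : V k) (i j : ℕ) :
    ∃ S : Finset (V k), S.card ≤ k ^ j ∧ ∀ y, ix x y = i → ix y x = j → y ∈ S := by
  classical
  refine ⟨Finset.univ.image (fun u : Fin j → Fin k => x.take (x.length - i) ++ List.ofFn u),
    ?_, ?_⟩
  · refine Finset.card_image_le.trans ?_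
    simp
  · intro y hi hj
    have h1 := lcp_le x y
    have h2 := lcp_le y x
    have h3 := lcp_take x y
    have h4 := lcp_comm x y
    unfold ix at hi hj
    simp only [Finset.mem_image, Finset.mem_univ, true_and]
    have hl : x.length - i = lcpLen x y := by omega
    refine ⟨fun n => y.get ⟨lcpLen x y + n, by omega⟩, ?_⟩
    rw [hl, h3]
    conv_rhs => rw [← List.take_append_drop (lcpLen x y) y]
    congr 1
    apply List.ext_getElem
    · simp; omega
    · intro n hn1 hn2
      simp

/-- Membership class. -/
def cls {k : ℕ} (x : V k) (i j : ℕ) : Set (V k) := {y | ix x y = i ∧ ix y x = j}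

theorem cls_finite {k : ℕ} (x : V k) (i j : ℕ) : (cls x i j).Finite := by
  obtain ⟨S, -, h⟩ := exists_finset x i j
  exact S.finite_toSet.subset fun y hy => h y hy.1 hy.2

theorem cls_card {k : ℕ} (x : V k) (i j : ℕ) : (cls x i j).ncard ≤ k ^ j := by
  obtain ⟨S, hS, h⟩ := exists_finset x i j
  refine le_trans ?_ hS
  rw [← Set.ncard_coe_finset]
  exact Set.ncard_le_ncard (fun y hy => h y hy.1 hy.2) S.finite_toSet

theorem tball_eq {k : ℕ} (x : V k) (r : ℕ) :
    ball x r = ⋃ j ∈ Finset.range (r + 1), ⋃ i ∈ Finset.range (r - j + 1), cls x i j := by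
  ext y
  simp only [ball, tdist_eq, cls, Set.mem_ofPred_eq, Set.mem_iUnion, Finset.mem_range]
  constructor
  · intro h
    exact ⟨ix y x, by omega, ix x y, by omega, rfl, rfl⟩
  · rintro ⟨j, hj, i, hi, h1, h2⟩
    omega

theorem ball_finite {k : ℕ} (x : V k) (r : ℕ) : (ball x r).Finite := by
  rw [tball_eq]
  exact Set.Finite.biUnion (Finset.finite_toSet _) fun j _ =>
    Set.Finite.biUnion (Finset.finite_toSet _) fun i _ => cls_finite x i j

theorem aux_sum {k : ℕ} (hk : 2 ≤ k) (r : ℕ) :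
    ∑ j ∈ Finset.range (r + 1), (r - j + 1) * k ^ j + (r + 3) ≤ 4 * k ^ r := by
  induction r with
  | zero => simp
  | succ r ih =>
    rw [Finset.sum_range_succ']
    have : ∀ j ∈ Finset.range (r + 1), (r + 1 - (j + 1) + 1) * k ^ (j + 1)
        = ((r - j + 1) * k ^ j) * k := by
      intro j hj
      rw [show r + 1 - (j + 1) = r - j by omega]; ring
    rw [Finset.sum_congr rfl this, ← Finset.sum_mul, pow_succ]
    have := Nat.mul_le_mul_right k ih
    simp
    nlinarith

theorem ball_card_le {k : ℕ} (hk : 2 ≤ k) (x : V k) (r : ℕ) :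
    (ball x r).ncard ≤ 4 * k ^ r := by
  rw [tball_eq]
  refine (Finset.set_ncard_biUnion_le _ _).trans ?_
  refine le_trans ?_ ((Nat.le_add_right _ _).trans (aux_sum hk r))
  refine Finset.sum_le_sum fun j _ => ?_
  refine (Finset.set_ncard_biUnion_le _ _).trans ?_
  refine (Finset.sum_le_sum fun i _ => cls_card x i j).trans ?_
  simp

theorem le_ball_card {k : ℕ} (x : V k) (r : ℕ) : k ^ r ≤ (ball x r).ncard := by
  classical
  have : k ^ r = (Finset.univ.image (fun u : Fin r → Fin k => x ++ List.ofFn u)).card := by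
    rw [Finset.card_image_of_injective]
    · simp
    · intro u v h
      simpa [List.ofFn_inj] using h
  rw [this, ← Set.ncard_coe_finset]
  refine Set.ncard_le_ncard ?_ (ball_finite x r)
  intro y hy
  simp only [Finset.coe_image, Set.mem_image, Finset.coe_univ, Set.mem_univ, true_and] at hy
  obtain ⟨u, rfl⟩ := hy
  simp [ball, tdist, lcp_append]

/-! ## Weighted estimates -/

theorem wsum_eq {k : ℕ} (w : V k → ℝ≥0∞) (A : Set (V k)) :
    wsum w A = ∑' x, A.indicator w x := tsum_subtype A w

theorem wsum_mono {k : ℕ} (w : V k → ℝ≥0∞) {A B : Set (V k)} (h : A ⊆ B) :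
    wsum w A ≤ wsum w B := ENNReal.tsum_mono_subtype w h

theorem wsum_finset {k : ℕ} (w : V k → ℝ≥0∞) {A : Set (V k)} (h : A.Finite) :
    wsum w A = ∑ x ∈ h.toFinset, w x := by
  have := Finset.tsum_subtype h.toFinset w
  rw [← this]
  unfold wsum
  have e : A = ↑h.toFinset := by simp
  conv_lhs => rw [e]
  rfl

theorem ballCard_pos {k : ℕ} (x : V k) (r : ℕ) : ballCard x r ≠ 0 := by
  have : x ∈ ball x r := by
    have h := lcp_append x []
    rw [List.append_nil] at h
    simp [ball, tdist, h]
  have := (Set.ncard_pos (ball_finite x r)).2 ⟨x, this⟩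
  unfold ballCard
  exact_mod_cast this.ne'

theorem ballCard_top {k : ℕ} (x : V k) (r : ℕ) : ballCard x r ≠ ⊤ := by
  simp [ballCard]

theorem wsum_ball_le {k : ℕ} (w : V k → ℝ≥0∞) (x : V k) (r : ℕ) :
    wsum w (ball x r) ≤ Mball w x * ballCard x r := by
  rw [← ENNReal.div_le_iff (ballCard_pos x r) (ballCard_top x r)]
  exact le_iSup (fun r => wsum w (ball x r) / ballCard x r) r

theorem holder {k : ℕ} {s : ℝ} (hs : 1 < s) (w : V k → ℝ≥0∞) (y : V k) (R : ℕ)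
    (A : Set (V k)) (hA : A ⊆ ball y R) (N : ℕ) (hN : A.ncard ≤ N) :
    wsum w A ≤ (N : ℝ≥0∞) ^ (1 - 1 / s) * ballCard y R ^ (1 / s) * MsBall s w y := by
  have hs0 : 0 < s := by linarith
  have hfin : A.Finite := (ball_finite y R).subset hA
  have h1 := ENNReal.rpow_sum_le_const_mul_sum_rpow hfin.toFinset w hs.le
  rw [← wsum_finset w hfin, ← wsum_finset (fun x => w x ^ s) hfin] at h1
  have hc : hfin.toFinset.card ≤ N := by rwa [← Set.ncard_eq_toFinset_card A hfin]
  have h2 : wsum w A ^ s ≤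
      (N : ℝ≥0∞) ^ (s - 1) * (Mball (fun x => w x ^ s) y * ballCard y R) := by
    refine h1.trans (mul_le_mul' ?_ ((wsum_mono _ hA).trans (wsum_ball_le _ _ _)))
    exact ENNReal.rpow_le_rpow (by exact_mod_cast hc) (by linarith)
  have h3 := ENNReal.rpow_le_rpow h2 (show 0 ≤ 1 / s by positivity)
  rw [← ENNReal.rpow_mul, mul_one_div_cancel hs0.ne', ENNReal.rpow_one,
    ENNReal.mul_rpow_of_nonneg _ _ (by positivity),
    ENNReal.mul_rpow_of_nonneg _ _ (by positivity), ← ENNReal.rpow_mul] at h3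
  refine h3.trans (le_of_eq ?_)
  rw [show (s - 1) * (1 / s) = 1 - 1 / s by field_simp]
  unfold MsBall
  ring

theorem ball_est {k : ℕ} {s : ℝ} (hs : 1 < s) (hk : 2 ≤ k) (w : V k → ℝ≥0∞) (y : V k) (R : ℕ) :
    wsum w (ball y R) ≤ 4 * (k : ℝ≥0∞) ^ R * MsBall s w y := by
  refine (holder hs w y R _ subset_rfl _ le_rfl).trans ?_
  refine mul_le_mul' ?_ le_rfl
  rw [show ((ball y R).ncard : ℝ≥0∞) = ballCard y R from rfl,
    ← ENNReal.rpow_add _ _ (ballCard_pos y R) (ballCard_top y R)]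
  simp only [sub_add_cancel, ENNReal.rpow_one]
  have := ball_card_le hk y R
  unfold ballCard
  exact_mod_cast this

theorem cls_est {k : ℕ} {s : ℝ} (hs : 1 < s) (hk : 2 ≤ k) (w : V k → ℝ≥0∞) (y : V k) (i j : ℕ) :
    wsum w (cls y j i) ≤ (k : ℝ≥0∞) ^ (i + j) *
      (4 * (((2 : ℝ≥0∞) ^ (-(1 - 1 / s))) ^ j * MsBall s w y)) := by
  have hs1 : 1 / s < 1 := by rw [div_lt_one (by linarith)]; exact hs
  have hs2 : 0 < 1 / s := by positivity
  have hk0 : (k : ℝ≥0∞) ≠ 0 := by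
    have : k ≠ 0 := by omega
    exact_mod_cast this
  have hsub : cls y j i ⊆ ball y (i + j) := by
    rintro x ⟨h1, h2⟩
    simp [ball, tdist_eq, h1, h2, add_comm]
  refine (holder hs w y (i + j) _ hsub _ (cls_card y j i)).trans ?_
  have hb : ballCard y (i + j) ≤ 4 * (k : ℝ≥0∞) ^ (i + j) := by
    have := ball_card_le hk y (i + j)
    unfold ballCard
    exact_mod_cast this
  have h1 : ballCard y (i + j) ^ (1 / s) ≤ 4 * ((k : ℝ≥0∞) ^ (i + j)) ^ (1 / s) := by
    refine (ENNReal.rpow_le_rpow hb hs2.le).trans ?_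
    rw [ENNReal.mul_rpow_of_nonneg _ _ hs2.le]
    gcongr
    calc (4 : ℝ≥0∞) ^ (1 / s) ≤ 4 ^ (1 : ℝ) :=
          ENNReal.rpow_le_rpow_of_exponent_le (by norm_num) hs1.le
      _ = 4 := ENNReal.rpow_one _
  have h2 : (k : ℝ≥0∞) ^ (-(1 - 1 / s)) ≤ (2 : ℝ≥0∞) ^ (-(1 - 1 / s)) := by
    rw [ENNReal.rpow_neg, ENNReal.rpow_neg]
    refine ENNReal.inv_le_inv.2 (ENNReal.rpow_le_rpow ?_ (by linarith))
    exact_mod_cast hk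
  have h3 : ((k ^ i : ℕ) : ℝ≥0∞) ^ (1 - 1 / s) * ((k : ℝ≥0∞) ^ (i + j)) ^ (1 / s)
      = (k : ℝ≥0∞) ^ (i + j) * ((k : ℝ≥0∞) ^ (-(1 - 1 / s))) ^ j := by
    push_cast
    simp only [← ENNReal.rpow_natCast, ← ENNReal.rpow_mul]
    rw [← ENNReal.rpow_add _ _ hk0 (by simp), ← ENNReal.rpow_add _ _ hk0 (by simp)]
    congr 1
    push_cast
    ring
  calc _ ≤ ((k ^ i : ℕ) : ℝ≥0∞) ^ (1 - 1 / s) * (4 * ((k : ℝ≥0∞) ^ (i + j)) ^ (1 / s))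
          * MsBall s w y := by gcongr
    _ = 4 * (((k ^ i : ℕ) : ℝ≥0∞) ^ (1 - 1 / s) * ((k : ℝ≥0∞) ^ (i + j)) ^ (1 / s))
          * MsBall s w y := by ring
    _ = 4 * ((k : ℝ≥0∞) ^ (i + j) * ((k : ℝ≥0∞) ^ (-(1 - 1 / s))) ^ j) * MsBall s w y := by
        rw [h3]
    _ ≤ 4 * ((k : ℝ≥0∞) ^ (i + j) * ((2 : ℝ≥0∞) ^ (-(1 - 1 / s))) ^ j) * MsBall s w y := by
        gcongr
    _ = _ := by ring

theorem tree_geom_le {k : ℕ} (hk : 2 ≤ k) (r : ℕ) :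
    ∑ j ∈ Finset.range (r + 1), k ^ j ≤ 2 * k ^ r := by
  induction r with
  | zero => simp
  | succ r ih =>
    rw [Finset.sum_range_succ, pow_succ]
    have := Nat.mul_le_mul_left (k ^ r) hk
    omega

theorem exists_sphere {k : ℕ} (hk : 2 ≤ k) (g : V k → ℝ≥0∞) (x : V k) (h : 1 < Mball g x) :
    ∃ r, (k : ℝ≥0∞) ^ r < 2 * wsum g (sph x r) := by
  by_contra! hc
  refine absurd h (not_lt.2 (iSup_le fun r => ?_))
  rw [ENNReal.div_le_iff (ballCard_pos x r) (ballCard_top x r), one_mul]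
  have h1 : wsum g (ball x r) ≤ ∑ j ∈ Finset.range (r + 1), wsum g (sph x j) := by
    have hsub : ball x r ⊆ ⋃ j ∈ Finset.range (r + 1), sph x j := by
      intro y hy
      simp only [ball, Set.mem_ofPred_eq] at hy
      simp only [Set.mem_iUnion, Finset.mem_range, sph, Set.mem_ofPred_eq]
      exact ⟨_, by omega, rfl⟩
    exact (wsum_mono g hsub).trans (ENNReal.tsum_biUnion_le g _ _)
  have h2 : 2 * wsum g (ball x r) ≤ 2 * ballCard x r := by
    calc 2 * wsum g (ball x r) ≤ 2 * ∑ j ∈ Finset.range (r + 1), wsum g (sph x j) := by gcongr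
      _ = ∑ j ∈ Finset.range (r + 1), 2 * wsum g (sph x j) := Finset.mul_sum _ _ _
      _ ≤ ∑ j ∈ Finset.range (r + 1), (k : ℝ≥0∞) ^ j := Finset.sum_le_sum fun j _ => hc j
      _ ≤ 2 * (k : ℝ≥0∞) ^ r := by exact_mod_cast tree_geom_le hk r
      _ ≤ 2 * ballCard x r := by
        gcongr
        unfold ballCard
        exact_mod_cast le_ball_card x r
  exact (ENNReal.mul_le_mul_iff_right (by norm_num) (by norm_num)).1 h2

/-- The pairs which are not small. -/
def big {k : ℕ} (g : V k → ℝ≥0∞) (x : V k) : Set (V k) :=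
  {y | (k : ℝ≥0∞) ^ ix x y < 8 * g y * (k : ℝ≥0∞) ^ ix y x}

theorem small_est {k : ℕ} (hk : 2 ≤ k) (g : V k → ℝ≥0∞) (x : V k) (i j : ℕ) :
    8 * wsum g (cls x i j \ big g x) ≤ (k : ℝ≥0∞) ^ i := by
  have hk0 : (k : ℝ≥0∞) ≠ 0 := by
    have : k ≠ 0 := by omega
    exact_mod_cast this
  have hfin : (cls x i j \ big g x).Finite := (cls_finite x i j).subset Set.sdiff_subset
  have hcard : hfin.toFinset.card ≤ k ^ j := by
    rw [← Set.ncard_eq_toFinset_card _ hfin]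
    exact (Set.ncard_le_ncard Set.sdiff_subset (cls_finite x i j)).trans (cls_card x i j)
  have h : (k : ℝ≥0∞) ^ j * (8 * wsum g (cls x i j \ big g x)) ≤
      (k : ℝ≥0∞) ^ j * (k : ℝ≥0∞) ^ i := by
    rw [wsum_finset g hfin, Finset.mul_sum, Finset.mul_sum]
    calc _ ≤ ∑ y ∈ hfin.toFinset, (k : ℝ≥0∞) ^ i := by
          refine Finset.sum_le_sum fun y hy => ?_
          rw [Set.Finite.mem_toFinset] at hy
          obtain ⟨⟨h1, h2⟩, h3⟩ := hy
          simp only [big, Set.mem_ofPred_eq, not_lt, h1, h2] at h3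
          rwa [mul_comm]
      _ = hfin.toFinset.card * (k : ℝ≥0∞) ^ i := by simp
      _ ≤ _ := by
        gcongr
        exact_mod_cast hcard
  exact (ENNReal.mul_le_mul_iff_right (pow_ne_zero _ hk0) (by simp)).1 h

theorem exists_big {k : ℕ} (hk : 2 ≤ k) (g : V k → ℝ≥0∞) (x : V k) (h : 1 < Mball g x) :
    ∃ r, (k : ℝ≥0∞) ^ r ≤ 4 * wsum g (sph x r ∩ big g x) := by
  obtain ⟨r, hr⟩ := exists_sphere hk g x h
  refine ⟨r, ?_⟩
  have hkt : (k : ℝ≥0∞) ^ r ≠ ⊤ := by simp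
  set U : Set (V k) := ⋃ j ∈ Finset.range (r + 1), (cls x (r - j) j \ big g x) with hU
  have hsub : sph x r ⊆ U ∪ (sph x r ∩ big g x) := by
    intro y hy
    by_cases hb : y ∈ big g x
    · exact Or.inr ⟨hy, hb⟩
    · left
      simp only [sph, Set.mem_ofPred_eq, tdist_eq] at hy
      simp only [hU, Set.mem_iUnion, Finset.mem_range]
      exact ⟨ix y x, by omega, ⟨by omega, rfl⟩, hb⟩
  have h1 : wsum g (sph x r) ≤ wsum g U + wsum g (sph x r ∩ big g x) :=
    (wsum_mono g hsub).trans (ENNReal.tsum_union_le g _ _)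
  have h2 : 8 * wsum g U ≤ 2 * (k : ℝ≥0∞) ^ r := by
    calc 8 * wsum g U ≤ 8 * ∑ j ∈ Finset.range (r + 1), wsum g (cls x (r - j) j \ big g x) := by
          gcongr
          exact ENNReal.tsum_biUnion_le g _ _
      _ = ∑ j ∈ Finset.range (r + 1), 8 * wsum g (cls x (r - j) j \ big g x) :=
          Finset.mul_sum _ _ _
      _ ≤ ∑ j ∈ Finset.range (r + 1), (k : ℝ≥0∞) ^ (r + 1 - 1 - j) :=
          Finset.sum_le_sum fun j _ => small_est hk g x (r - j) j
      _ = ∑ j ∈ Finset.range (r + 1), (k : ℝ≥0∞) ^ j :=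
          Finset.sum_range_reflect (fun j => (k : ℝ≥0∞) ^ j) (r + 1)
      _ ≤ 2 * (k : ℝ≥0∞) ^ r := by exact_mod_cast tree_geom_le hk r
  have h3 : 4 * (k : ℝ≥0∞) ^ r ≤
      2 * (k : ℝ≥0∞) ^ r + 8 * wsum g (sph x r ∩ big g x) := by
    calc 4 * (k : ℝ≥0∞) ^ r ≤ 4 * (2 * (wsum g U + wsum g (sph x r ∩ big g x))) := by
          gcongr
          exact hr.le.trans (by gcongr)
      _ = 8 * wsum g U + 8 * wsum g (sph x r ∩ big g x) := by ring
      _ ≤ _ := by gcongr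
  have h4 : 2 * (k : ℝ≥0∞) ^ r + 2 * (k : ℝ≥0∞) ^ r ≤
      2 * (k : ℝ≥0∞) ^ r + 2 * (4 * wsum g (sph x r ∩ big g x)) := by
    calc _ = 4 * (k : ℝ≥0∞) ^ r := by ring
      _ ≤ _ := h3
      _ = _ := by ring
  have h5 := (ENNReal.add_le_add_iff_left (ENNReal.mul_ne_top (by norm_num) hkt)).1 h4
  exact (ENNReal.mul_le_mul_iff_right (by norm_num) (by norm_num)).1 h5

/-- Validity of a pair of heights with respect to the value `t`. -/
def valid (k : ℕ) (t : ℝ≥0∞) (j : ℕ) : Set ℕ :=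
  {i | t < (k : ℝ≥0∞) ^ (i + j) ∧ (k : ℝ≥0∞) ^ i < 8 * t * (k : ℝ≥0∞) ^ j}

theorem valid_card {k : ℕ} (hk : 2 ≤ k) (t : ℝ≥0∞) (j : ℕ) :
    ∑' i, (valid k t j).indicator (fun _ => (1 : ℝ≥0∞)) i ≤ ((2 * j + 3 : ℕ) : ℝ≥0∞) := by
  classical
  by_cases hne : ∃ i, i ∈ valid k t j
  · set i0 := Nat.find hne with hi0
    have h0 : i0 ∈ valid k t j := Nat.find_spec hne
    have hsub : valid k t j ⊆ ↑(Finset.Ico i0 (i0 + (2 * j + 3))) := by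
      intro i hi
      have hlo : i0 ≤ i := Nat.find_min' hne hi
      have hlt : (k : ℝ≥0∞) ^ i < (k : ℝ≥0∞) ^ (i0 + (2 * j + 3)) := by
        calc (k : ℝ≥0∞) ^ i < 8 * t * (k : ℝ≥0∞) ^ j := hi.2
          _ ≤ (k : ℝ≥0∞) ^ 3 * (k : ℝ≥0∞) ^ (i0 + j) * (k : ℝ≥0∞) ^ j := by
            gcongr
            · have : 2 ^ 3 ≤ k ^ 3 := Nat.pow_le_pow_left hk 3
              norm_num at this
              exact_mod_cast this
            · exact h0.1.le
          _ = _ := by ring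
      have hlt' : k ^ i < k ^ (i0 + (2 * j + 3)) := by exact_mod_cast hlt
      have := (Nat.pow_lt_pow_iff_right (by omega)).1 hlt'
      simp only [Finset.coe_Ico, Set.mem_Ico]
      omega
    calc _ ≤ ∑' i, (↑(Finset.Ico i0 (i0 + (2 * j + 3))) : Set ℕ).indicator
            (fun _ => (1 : ℝ≥0∞)) i :=
          ENNReal.tsum_le_tsum fun i => Set.indicator_le_indicator_of_subset hsub (by simp) i
      _ = ∑ i ∈ Finset.Ico i0 (i0 + (2 * j + 3)), (1 : ℝ≥0∞) := by
          rw [← tsum_subtype]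
          exact Finset.tsum_subtype _ (fun _ => (1 : ℝ≥0∞))
      _ ≤ _ := by simp
  · push Not at hne
    have : valid k t j = ∅ := Set.eq_empty_of_forall_notMem hne
    simp [this]

/-- The kernel used in the Chebyshev step. -/
def ker {k : ℕ} (g : V k → ℝ≥0∞) (x y : V k) : ℝ≥0∞ :=
  (valid k (g y) (ix y x)).indicator (fun i => ((k : ℝ≥0∞) ^ (i + ix y x))⁻¹) (ix x y)

/-- The constant. -/
def cst (s : ℝ) : ℝ≥0∞ :=
  ∑' j : ℕ, ((2 : ℝ≥0∞) ^ (-(1 - 1 / s))) ^ j * ((2 * j + 3 : ℕ) : ℝ≥0∞)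

theorem ker_est {k : ℕ} {s : ℝ} (hs : 1 < s) (hk : 2 ≤ k) (w g : V k → ℝ≥0∞) (y : V k) :
    ∑' x, w x * ker g x y ≤ 4 * cst s * MsBall s w y := by
  classical
  have hk0 : (k : ℝ≥0∞) ≠ 0 := by
    have : k ≠ 0 := by omega
    exact_mod_cast this
  set q := (2 : ℝ≥0∞) ^ (-(1 - 1 / s)) with hq
  let I : ℕ → ℕ → ℝ≥0∞ := fun j i => (valid k (g y) j).indicator (fun _ => (1 : ℝ≥0∞)) i
  have h1 : ∀ x, w x * ker g x y ≤ ∑' j, ∑' i,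
      I j i * ((k : ℝ≥0∞) ^ (i + j))⁻¹ * (cls y j i).indicator w x := by
    intro x
    refine le_trans ?_ (ENNReal.le_tsum (ix y x))
    refine le_trans ?_ (ENNReal.le_tsum (ix x y))
    have : x ∈ cls y (ix y x) (ix x y) := ⟨rfl, rfl⟩
    rw [Set.indicator_of_mem this]
    simp only [I, ker]
    by_cases hv : ix x y ∈ valid k (g y) (ix y x)
    · simp [hv, mul_comm]
    · simp [hv]
  calc ∑' x, w x * ker g x y
      ≤ ∑' x, ∑' j, ∑' i, I j i * ((k : ℝ≥0∞) ^ (i + j))⁻¹ * (cls y j i).indicator w x :=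
        ENNReal.tsum_le_tsum h1
    _ = ∑' j, ∑' i, I j i * ((k : ℝ≥0∞) ^ (i + j))⁻¹ * wsum w (cls y j i) := by
        rw [ENNReal.tsum_comm]
        refine tsum_congr fun j => ?_
        rw [ENNReal.tsum_comm]
        refine tsum_congr fun i => ?_
        rw [ENNReal.tsum_mul_left, wsum_eq]
    _ ≤ ∑' j, ∑' i, I j i * (4 * (q ^ j * MsBall s w y)) := by
        refine ENNReal.tsum_le_tsum fun j => ENNReal.tsum_le_tsum fun i => ?_
        rw [mul_assoc]
        refine mul_le_mul' le_rfl ?_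
        refine (mul_le_mul' le_rfl (cls_est hs hk w y i j)).trans (le_of_eq ?_)
        rw [← mul_assoc, ENNReal.inv_mul_cancel (pow_ne_zero _ hk0) (by simp), one_mul]
    _ ≤ ∑' j : ℕ, ((2 * j + 3 : ℕ) : ℝ≥0∞) * (4 * (q ^ j * MsBall s w y)) := by
        refine ENNReal.tsum_le_tsum fun j => ?_
        rw [ENNReal.tsum_mul_right]
        exact mul_le_mul' (valid_card hk (g y) j) le_rfl
    _ = 4 * cst s * MsBall s w y := by
        unfold cst
        rw [← ENNReal.tsum_mul_left, ← ENNReal.tsum_mul_right]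
        refine tsum_congr fun j => ?_
        rw [← hq]
        ring

theorem peak_est {k : ℕ} {s : ℝ} (hs : 1 < s) (hk : 2 ≤ k) (w g : V k → ℝ≥0∞) (y : V k)
    (hg : g y ≠ ⊤) :
    wsum w {x | (k : ℝ≥0∞) ^ tdist x y ≤ g y} ≤ 4 * g y * MsBall s w y := by
  classical
  by_cases hne : ∃ r : ℕ, (k : ℝ≥0∞) ^ r ≤ g y
  · obtain ⟨N, hN⟩ := ENNReal.exists_nat_gt hg
    have hb : ∀ r : ℕ, (k : ℝ≥0∞) ^ r ≤ g y → r ≤ N := by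
      intro r hr
      have h1 : k ^ r < N := by exact_mod_cast hr.trans_lt hN
      exact ((Nat.lt_pow_self (by omega)).trans h1).le
    obtain ⟨r0, hr0⟩ := hne
    have hR := Nat.findGreatest_spec (P := fun r => (k : ℝ≥0∞) ^ r ≤ g y) (hb r0 hr0) hr0
    set R := Nat.findGreatest (fun r => (k : ℝ≥0∞) ^ r ≤ g y) N with hRdef
    have hsub : {x | (k : ℝ≥0∞) ^ tdist x y ≤ g y} ⊆ ball y R := by
      intro x hx
      have hx' : (k : ℝ≥0∞) ^ tdist x y ≤ g y := hx
      rw [tdist_comm'] at hx'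
      exact Nat.le_findGreatest (P := fun r => (k : ℝ≥0∞) ^ r ≤ g y) (hb _ hx') hx'
    refine (wsum_mono w hsub).trans ((ball_est hs hk w y R).trans ?_)
    gcongr
  · push Not at hne
    have : {x | (k : ℝ≥0∞) ^ tdist x y ≤ g y} = ∅ :=
      Set.eq_empty_of_forall_notMem fun x hx => absurd hx (not_le.2 (hne _))
    simp [this, wsum]

theorem point_est {k : ℕ} (hk : 2 ≤ k) (g : V k → ℝ≥0∞) (x : V k) (h : 1 < Mball g x) :
    1 ≤ ∑' y, (({x | (k : ℝ≥0∞) ^ tdist x y ≤ g y} : Set (V k)).indicator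
      (fun _ => (1 : ℝ≥0∞)) x + 4 * g y * ker g x y) := by
  classical
  have hk0 : (k : ℝ≥0∞) ≠ 0 := by
    have : k ≠ 0 := by omega
    exact_mod_cast this
  by_cases hp : ∃ y, (k : ℝ≥0∞) ^ tdist x y ≤ g y
  · obtain ⟨y, hy⟩ := hp
    refine le_trans ?_ (ENNReal.le_tsum y)
    rw [Set.indicator_of_mem (by exact hy)]
    exact le_self_add
  · push Not at hp
    obtain ⟨r, hr⟩ := exists_big hk g x h
    have h1 : 1 ≤ ((k : ℝ≥0∞) ^ r)⁻¹ * (4 * wsum g (sph x r ∩ big g x)) := by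
      rw [← ENNReal.inv_mul_cancel (pow_ne_zero r hk0) (by simp)]
      gcongr
    refine h1.trans ?_
    rw [wsum_eq, ← ENNReal.tsum_mul_left, ← ENNReal.tsum_mul_left]
    refine ENNReal.tsum_le_tsum fun y => ?_
    refine le_trans ?_ le_add_self
    by_cases hy : y ∈ sph x r ∩ big g x
    · rw [Set.indicator_of_mem hy]
      have hd : ix x y + ix y x = r := by rw [← tdist_eq]; exact hy.1
      have hv : ix x y ∈ valid k (g y) (ix y x) := by
        refine ⟨?_, hy.2⟩
        rw [← tdist_eq]
        exact hp y
      unfold ker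
      rw [Set.indicator_of_mem hv, hd, mul_comm]
    · rw [Set.indicator_of_notMem hy]
      simp

theorem core {k : ℕ} {s : ℝ} (hs : 1 < s) (hk : 2 ≤ k) (w g : V k → ℝ≥0∞)
    (hg : ∀ y, g y ≠ ⊤) :
    wsum w {x | 1 < Mball g x} ≤ (4 + 16 * cst s) * ∑' y, g y * MsBall s w y := by
  classical
  calc wsum w {x | 1 < Mball g x}
      ≤ ∑' x, w x * ∑' y, (({x | (k : ℝ≥0∞) ^ tdist x y ≤ g y} : Set (V k)).indicator
          (fun _ => (1 : ℝ≥0∞)) x + 4 * g y * ker g x y) := by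
        rw [wsum_eq]
        refine ENNReal.tsum_le_tsum fun x => ?_
        by_cases hx : 1 < Mball g x
        · rw [Set.indicator_of_mem (by exact hx)]
          exact le_mul_of_one_le_right' (point_est hk g x hx)
        · rw [Set.indicator_of_notMem (by exact hx)]
          exact zero_le
    _ = ∑' y, (wsum w {x | (k : ℝ≥0∞) ^ tdist x y ≤ g y}
          + 4 * g y * ∑' x, w x * ker g x y) := by
        simp_rw [← ENNReal.tsum_mul_left]
        rw [ENNReal.tsum_comm]
        refine tsum_congr fun y => ?_
        rw [wsum_eq, ← ENNReal.tsum_add]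
        refine tsum_congr fun x => ?_
        rw [mul_add]
        congr 1
        · simp [Set.indicator_apply]
        · ring
    _ ≤ ∑' y, (4 + 16 * cst s) * (g y * MsBall s w y) := by
        refine ENNReal.tsum_le_tsum fun y => ?_
        calc _ ≤ 4 * g y * MsBall s w y + 4 * g y * (4 * cst s * MsBall s w y) :=
              add_le_add (peak_est hs hk w g y (hg y)) (mul_le_mul' le_rfl (ker_est hs hk w g y))
          _ = _ := by ring
    _ = _ := ENNReal.tsum_mul_left

theorem cst_ne_top {s : ℝ} (hs : 1 < s) : cst s ≠ ⊤ := by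
  have hs1 : 1 / s < 1 := by rw [div_lt_one (by linarith)]; exact hs
  set q : ℝ≥0 := (2 : ℝ≥0) ^ (-(1 - 1 / s)) with hq
  have hq1 : q < 1 := NNReal.rpow_lt_one_of_one_lt_of_neg (by norm_num) (by linarith)
  have hqe : (2 : ℝ≥0∞) ^ (-(1 - 1 / s)) = (q : ℝ≥0∞) := by
    rw [hq, ENNReal.coe_rpow_of_ne_zero (by norm_num)]
    norm_num
  have hn : ‖(q : ℝ)‖ < 1 := by
    rw [Real.norm_of_nonneg q.coe_nonneg]
    exact_mod_cast hq1
  have hsum : Summable fun j : ℕ => q ^ j * ((2 * j + 3 : ℕ) : ℝ≥0) := by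
    rw [← NNReal.summable_coe]
    have h1 := (summable_pow_mul_geometric_of_norm_lt_one 1 hn).mul_left 2
    have h0 := (summable_geometric_of_norm_lt_one hn).mul_left 3
    refine (h1.add h0).congr fun j => ?_
    push_cast
    ring
  unfold cst
  rw [hqe]
  have := ENNReal.tsum_coe_ne_top_iff_summable.2 hsum
  push_cast at this ⊢
  exact this

theorem Mball_smul {k : ℕ} (a : ℝ≥0∞) (f : V k → ℝ≥0∞) (x : V k) :
    Mball (fun y => a * f y) x = a * Mball f x := by
  unfold Mball wsum
  rw [ENNReal.mul_iSup]
  refine iSup_congr fun r => ?_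
  rw [ENNReal.tsum_mul_left, mul_div_assoc]

/-- Fefferman–Stein weak type (1,1) estimate on the infinite rooted `k`-ary tree:
for `s > 1`, `w({Mf > λ}) ≤ c_s (1/λ) Σ_x |f(x)| M_s w(x)` with `c_s`
depending only on `s` (independent of `k`). -/
theorem stmt7 (s : ℝ) (hs : 1 < s) :
    ∃ c : ℝ≥0, ∀ (k : ℕ), 2 ≤ k → ∀ (w : V k → ℝ≥0∞) (f : V k → ℝ),
      Summable (fun x => |f x|) → ∀ lam : ℝ, 0 < lam →
      wsum w {x : V k | ENNReal.ofReal lam < Mball (absE f) x} ≤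
        (c : ℝ≥0∞) * (ENNReal.ofReal lam)⁻¹ *
          ∑' x : V k, ENNReal.ofReal |f x| * MsBall s w x := by
  refine ⟨(4 + 16 * cst s).toNNReal, ?_⟩
  intro k hk w f _ lam hlam
  have hl0 : ENNReal.ofReal lam ≠ 0 := by simpa using hlam
  have hlt : ENNReal.ofReal lam ≠ ⊤ := ENNReal.ofReal_ne_top
  have hC : 4 + 16 * cst s ≠ ⊤ :=
    ENNReal.add_ne_top.2 ⟨by norm_num, ENNReal.mul_ne_top (by norm_num) (cst_ne_top hs)⟩
  rw [ENNReal.coe_toNNReal hC]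
  have hsub : {x : V k | ENNReal.ofReal lam < Mball (absE f) x} ⊆
      {x | 1 < Mball (fun y => (ENNReal.ofReal lam)⁻¹ * absE f y) x} := by
    intro x hx
    have hx' : ENNReal.ofReal lam < Mball (absE f) x := hx
    show 1 < Mball (fun y => (ENNReal.ofReal lam)⁻¹ * absE f y) x
    rw [Mball_smul, ← ENNReal.inv_mul_cancel hl0 hlt]
    exact (ENNReal.mul_lt_mul_iff_right (by simp) (by simpa using hlam)).2 hx'
  refine (wsum_mono w hsub).trans ((core hs hk w _ ?_).trans (le_of_eq ?_))
  · intro y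
    exact ENNReal.mul_ne_top (by simpa using hlam) ENNReal.ofReal_ne_top
  · rw [mul_assoc, ← ENNReal.tsum_mul_left (a := (ENNReal.ofReal lam)⁻¹)]
    simp only [absE, mul_assoc]
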